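/- arXiv:1512.07573 — 7 statements merged into one kernel-verified Lean document; each statement's English description precedes it below -/
import Mathlib

section
/- For each n ≥ 0 and 0 ≤ i ≤ n, the codegeneracy map s^i : [n+1] → [n] is a pushout of s^0 : [1] → [0] along an inert map: the square with top edge the inert map [1] → [n+1] with image {i, i+1}, left edge s^0 : [1] → [0], right edge s^i : [n+1] → [n], and bottom edge the inert map [0] → [n] with image {i}, is a pushout in Δ. Similarly, for 0 < i < n, the inner coface map d^i : [n−1] → [n] is a pushout of d^1 : [1] → [2] along an inert map: the square with top edge the inert map [1] → [n−1] with image {i−1, i}, left edge d^1 : [1] → [2], right edge d^i : [n−1] → [n], and bottom edge the inert map [2] → [n] with image {i−1, i, i+1}, is a pushout in Δ. -/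
open CategoryTheory Simplicial

/-- A morphism of the simplex category is *active* (generic) if it preserves endpoints. -/
def IsActive {x y : SimplexCategory} (f : x ⟶ y) : Prop :=
  f.toOrderHom 0 = 0 ∧ f.toOrderHom (Fin.last x.len) = Fin.last y.len

/-- A morphism of the simplex category is *inert* (free) if it is distance-preserving.
The inert map `[l] ⟶ [n]` with image `{j, …, j+l}` is `SimplexCategory.subinterval j l _`. -/
def IsInert {x y : SimplexCategory} (f : x ⟶ y) : Prop :=
  ∀ i : Fin x.len, (f.toOrderHom i.succ : ℕ) = (f.toOrderHom i.castSucc : ℕ) + 1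

namespace SimplexCategory

lemma hom_ext_apply {a b : SimplexCategory} {f g : a ⟶ b}
    (h : ∀ x, f.toOrderHom x = g.toOrderHom x) : f = g :=
  Hom.ext f g (OrderHom.ext _ _ (funext h))

/-- A commutative square in the simplex category is a pushout as soon as its two legs into the
corner are jointly surjective and every cocone factors through the corner. -/
lemma isPushout_of_jointly_surjective {a b c d : SimplexCategory}
    {f : a ⟶ b} {g : a ⟶ c} {inl : b ⟶ d} {inr : c ⟶ d} (w : f ≫ inl = g ≫ inr)
    (hsurj : ∀ z, (∃ x, inl.toOrderHom x = z) ∨ ∃ y, inr.toOrderHom y = z)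
    (hdesc : ∀ {e : SimplexCategory} (u : b ⟶ e) (v : c ⟶ e), f ≫ u = g ≫ v →
      ∃ t : d ⟶ e, inl ≫ t = u ∧ inr ≫ t = v) :
    IsPushout f g inl inr := by
  choose t hl hr using fun s : Limits.PushoutCocone f g => hdesc s.inl s.inr s.condition
  refine ⟨⟨w⟩, ⟨Limits.PushoutCocone.IsColimit.mk w t hl hr fun s m h₁ h₂ => ?_⟩⟩
  refine hom_ext_apply fun z => ?_
  rcases hsurj z with ⟨x, rfl⟩ | ⟨y, rfl⟩
  · exact congrArg (fun q => q.toOrderHom x) (h₁.trans (hl s).symm)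
  · exact congrArg (fun q => q.toOrderHom y) (h₂.trans (hr s).symm)

lemma subinterval_toOrderHom_apply {n : ℕ} (j l : ℕ) (h : j + l ≤ n) (x : Fin (l + 1)) :
    (subinterval j l h).toOrderHom x = (⟨x + j, by lia⟩ : Fin (n + 1)) :=
  rfl

lemma σ_toOrderHom_val {n : ℕ} (i : Fin (n + 1)) (x : Fin (n + 2)) :
    ((σ i).toOrderHom x).val = if x.val ≤ i.val then x.val else x.val - 1 := by
  change (Fin.predAbove i x).val = _
  simp only [Fin.predAbove, Fin.lt_def, Fin.val_castSucc]
  split_ifs <;> first | rfl | omega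

lemma δ_toOrderHom_val {n : ℕ} (i : Fin (n + 2)) (x : Fin (n + 1)) :
    ((δ i).toOrderHom x).val = if x.val < i.val then x.val else x.val + 1 := by
  change (Fin.succAbove i x).val = _
  simp only [Fin.succAbove, Fin.lt_def, Fin.val_castSucc]
  split_ifs <;> rfl

lemma isPushout_subinterval_σ (n : ℕ) (i : Fin (n + 1)) :
    IsPushout (subinterval (n := n + 1) (i : ℕ) 1 (by lia)) (σ (0 : Fin 1)) (σ i)
      (subinterval (n := n) (i : ℕ) 0 (by lia)) := by
  have hσδ : δ i.succ ≫ σ i = 𝟙 _ := δ_comp_σ_succ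
  refine isPushout_of_jointly_surjective ?_ (fun z => .inl ⟨(δ i.succ).toOrderHom z, ?_⟩) ?_
  · refine hom_ext_apply fun x => Fin.ext ?_
    change ((σ i).toOrderHom ⟨x.val + i, _⟩).val = ((σ (0 : Fin 1)).toOrderHom x).val + i
    rw [σ_toOrderHom_val, σ_toOrderHom_val]
    have : x.val < 2 := x.isLt
    simp only [Fin.val_zero]
    split_ifs <;> omega
  · exact congrArg (fun q => q.toOrderHom z) hσδ
  · intro e u v huv
    have hpt : ∀ x : Fin 2, u.toOrderHom (⟨x.val + i, by lia⟩ : Fin (n + 2)) =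
        v.toOrderHom (0 : Fin 1) := fun x =>
      (congrArg (fun q => q.toOrderHom x) huv).trans
        (congrArg v.toOrderHom (Subsingleton.elim (α := Fin 1) _ _))
    have hu : σ i ≫ δ i.succ ≫ u = u := by
      refine hom_ext_apply fun (x : Fin (n + 2)) => ?_
      change u.toOrderHom ((δ i.succ).toOrderHom ((σ i).toOrderHom x)) = u.toOrderHom x
      by_cases hx : x.val = i.val + 1
      · have hx' : x = ⟨(1 : Fin 2).val + i, by simp; lia⟩ := Fin.ext (by simp [hx]; omega)
        have hy : (δ i.succ).toOrderHom ((σ i).toOrderHom x) =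
            (⟨(0 : Fin 2).val + i, by simp; lia⟩ : Fin (n + 2)) := by
          refine Fin.ext ?_
          rw [δ_toOrderHom_val, σ_toOrderHom_val]
          simp [hx]
        rw [hy, hx', hpt, hpt]
      · congr 1
        refine Fin.ext ?_
        rw [δ_toOrderHom_val, σ_toOrderHom_val]
        simp only [Fin.val_succ]
        split_ifs <;> omega
    refine ⟨δ i.succ ≫ u, hu, ?_⟩
    refine hom_ext_apply fun (x : Fin 1) => ?_
    obtain rfl : x = 0 := Subsingleton.elim _ _
    rw [← hpt 0]
    change u.toOrderHom ((δ i.succ).toOrderHom _) = _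
    congr 1
    refine Fin.ext ?_
    rw [δ_toOrderHom_val, subinterval_toOrderHom_apply]
    simp

lemma isPushout_subinterval_δ (m p : ℕ) (hp : p < m) :
    IsPushout (subinterval (n := m) p 1 (by lia)) (δ (1 : Fin 3))
      (δ (⟨p + 1, by lia⟩ : Fin (m + 2))) (subinterval (n := m + 1) p 2 (by lia)) := by
  refine isPushout_of_jointly_surjective ?_ (fun (z : Fin (m + 2)) => ?_) ?_
  · refine hom_ext_apply fun x => Fin.ext ?_
    change ((δ (⟨p + 1, _⟩ : Fin (m + 2))).toOrderHom ⟨x.val + p, _⟩).val =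
      ((δ (1 : Fin 3)).toOrderHom x).val + p
    rw [δ_toOrderHom_val, δ_toOrderHom_val]
    simp only [Fin.val_one]
    split_ifs <;> omega
  · rcases lt_trichotomy z.val (p + 1) with hz | hz | hz
    · refine .inl ⟨(⟨z.val, by lia⟩ : Fin (m + 1)), Fin.ext ?_⟩
      rw [δ_toOrderHom_val]
      simp [hz]
    · refine .inr ⟨(1 : Fin 3), Fin.ext ?_⟩
      rw [subinterval_toOrderHom_apply]
      simp [hz, add_comm]
    · refine .inl ⟨(⟨z.val - 1, by lia⟩ : Fin (m + 1)), Fin.ext ?_⟩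
      rw [δ_toOrderHom_val]
      simp only
      split_ifs <;> omega
  · intro e u v huv
    have h₀ : u.toOrderHom (⟨p, by lia⟩ : Fin (m + 1)) = v.toOrderHom (0 : Fin 3) :=
      (congrArg u.toOrderHom (Fin.ext (Nat.zero_add p).symm)).trans
        (congrArg (fun q => q.toOrderHom (0 : Fin 2)) huv)
    have h₁ : u.toOrderHom (⟨p + 1, by lia⟩ : Fin (m + 1)) = v.toOrderHom (2 : Fin 3) :=
      (congrArg u.toOrderHom (Fin.ext (Nat.add_comm p 1))).trans
        (congrArg (fun q => q.toOrderHom (1 : Fin 2)) huv)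
    have hv₀ : v.toOrderHom (0 : Fin 3) ≤ v.toOrderHom (1 : Fin 3) :=
      v.toOrderHom.monotone (by decide : (0 : Fin 3) ≤ 1)
    have hv₁ : v.toOrderHom (1 : Fin 3) ≤ v.toOrderHom (2 : Fin 3) :=
      v.toOrderHom.monotone (by decide : (1 : Fin 3) ≤ 2)
    let σp : Fin (m + 2) → Fin (m + 1) := fun k => ⟨if k.val ≤ p then k.val else k.val - 1, by
      split_ifs <;> lia⟩
    let t : Fin (m + 2) → Fin (e.len + 1) := fun k =>
      if k.val = p + 1 then v.toOrderHom (1 : Fin 3) else u.toOrderHom (σp k)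
    have ht : Monotone t := by
      intro k l hkl
      have hkl' : k.val ≤ l.val := hkl
      simp only [t]
      split_ifs with hk hl hl
      · exact le_rfl
      · rw [← h₁] at hv₁
        refine hv₁.trans (u.toOrderHom.monotone (Fin.le_def.mpr ?_))
        simp only [σp]
        split_ifs <;> omega
      · rw [← h₀] at hv₀
        refine le_trans (u.toOrderHom.monotone (Fin.le_def.mpr ?_)) hv₀
        simp only [σp]
        split_ifs <;> omega
      · refine u.toOrderHom.monotone (Fin.le_def.mpr ?_)
        simp only [σp]
        split_ifs <;> omega
    refine ⟨Hom.mk ⟨t, ht⟩, hom_ext_apply fun (x : Fin (m + 1)) => ?_,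
      hom_ext_apply fun (x : Fin 3) => ?_⟩
    · change t ((δ _).toOrderHom x) = _
      have hx := δ_toOrderHom_val (⟨p + 1, by lia⟩ : Fin (m + 2)) x
      simp only at hx
      simp only [t]
      rw [if_neg (by rw [hx]; split_ifs <;> omega)]
      congr 1
      refine Fin.ext ?_
      simp only [σp]
      rw [hx]
      split_ifs <;> omega
    · change t ⟨x.val + p, _⟩ = _
      fin_cases x
      · simp [t, σp, h₀]
      · simp [t, add_comm]
      · simp [t, σp, ← h₁, add_comm]

end SimplexCategory

/-- Every codegeneracy `s^i : [n+1] ⟶ [n]` is a pushout of `s^0 : [1] ⟶ [0]` along an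
inert map, and every inner coface `d^i : [n-1] ⟶ [n]` (here written
`d^i : [m] ⟶ [m+1]`, `0 < i < m+1`) is a pushout of `d^1 : [1] ⟶ [2]` along an inert
map, via the indicated squares. -/
theorem degeneracy_face_pushouts :
    (∀ (n : ℕ) (i : Fin (n + 1)),
      IsPushout (SimplexCategory.subinterval (n := n + 1) (i : ℕ) 1
          (by have := i.is_lt; omega))
        (SimplexCategory.σ (0 : Fin 1))
        (SimplexCategory.σ i)
        (SimplexCategory.subinterval (n := n) (i : ℕ) 0
          (by have := i.is_lt; omega))) ∧
    (∀ (m i : ℕ) (_ : 0 < i) (_ : i < m + 1),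
      IsPushout (SimplexCategory.subinterval (n := m) (i - 1) 1 (by omega))
        (SimplexCategory.δ (1 : Fin 3))
        (SimplexCategory.δ (⟨i, by omega⟩ : Fin (m + 2)))
        (SimplexCategory.subinterval (n := m + 1) (i - 1) 2 (by omega))) := by
  refine ⟨SimplexCategory.isPushout_subinterval_σ, fun m i hi him => ?_⟩
  cases i with
  | zero => exact absurd hi (lt_irrefl 0)
  | succ p => exact SimplexCategory.isPushout_subinterval_δ m p (by lia)
end

section
/- If a simplicial map F : Y → X between simplicial objects in a category C is cartesian on all outer coface maps (that is, on every bottom coface d^0 and every top coface d^n : [n−1] → [n]), and X is a Segal object, then Y is a Segal object. -/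
open CategoryTheory CategoryTheory.Limits Simplicial Opposite

variable {C : Type*} [Category C]

/-- A simplicial object is a *Segal object* if for every `n > 0` the square with
horizontal edges `d_⊥ : X_{n+1} ⟶ X_n`, `d_⊥ : X_n ⟶ X_{n-1}` and vertical edges
`d_⊤ : X_{n+1} ⟶ X_n`, `d_⊤ : X_n ⟶ X_{n-1}` is a pullback. -/
def IsSegal (X : SimplicialObject C) : Prop :=
  ∀ n : ℕ, IsPullback (X.δ (0 : Fin (n + 3))) (X.δ (Fin.last (n + 2)))
      (X.δ (Fin.last (n + 1))) (X.δ (0 : Fin (n + 2)))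

/-- A simplicial map is *cartesian* on an arrow `α` of `Δ` if the corresponding
naturality square is a pullback. -/
def CartesianOn {X Y : SimplicialObject C} (F : Y ⟶ X)
    {x y : SimplexCategory} (α : x ⟶ y) : Prop :=
  IsPullback (Y.map α.op) (F.app (op y)) (F.app (op x)) (X.map α.op)

/-- If a simplicial map `F : Y ⟶ X` is cartesian on all outer coface maps (every bottom
coface `d^0` and every top coface `d^n`), and `X` is a Segal object, then `Y` is a Segal
object. -/
theorem isSegal_of_cartesianOn_outer {X Y : SimplicialObject C} (F : Y ⟶ X)
    (hbot : ∀ n : ℕ, CartesianOn F (SimplexCategory.δ (0 : Fin (n + 2))))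
    (htop : ∀ n : ℕ, CartesianOn F (SimplexCategory.δ (Fin.last (n + 1))))
    (hX : IsSegal X) : IsSegal Y := by
  intro n
  have total := (hbot (n + 1)).paste_vert (hX n)
  have nat_top (k : ℕ) : F.app (op ⦋k + 1⦌) ≫ X.δ (Fin.last (k + 1)) =
      Y.δ (Fin.last (k + 1)) ≫ F.app (op ⦋k⦌) :=
    (F.naturality (SimplexCategory.δ (Fin.last (k + 1))).op).symm
  rw [nat_top (n + 1), nat_top n] at total
  exact IsPullback.of_bot total (Y.δ_comp_δ (Fin.zero_le (Fin.last (n + 1)))).symm (hbot n)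
end

section
/- Every Segal object in a category C is a decomposition object: if X is a simplicial object in C such that for every n > 0 the square with horizontal edges d_⊥ : X_{n+1} → X_n and d_⊥ : X_n → X_{n−1} and vertical edges d_⊤ : X_{n+1} → X_n and d_⊤ : X_n → X_{n−1} is a pullback, then X sends every pushout in Δ of an active map along an inert map to a pullback in C. -/
open CategoryTheory CategoryTheory.Limits Simplicial Opposite

variable {C : Type*} [Category C]

/-- A simplicial object is a *decomposition object* if it sends every pushout in `Δ` of
an active map along an inert map to a pullback square. -/
def IsDecomp (X : SimplicialObject C) : Prop :=
  ∀ ⦃n m k p : SimplexCategory⦄ (f : n ⟶ m) (g : n ⟶ k) (r : m ⟶ p) (s : k ⟶ p),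
    IsInert f → IsActive g → IsPushout f g r s →
    IsPullback (X.map r.op) (X.map s.op) (X.map f.op) (X.map g.op)

/-! ### Morphisms of the simplex category as functions on natural numbers -/

namespace SimplexCategory

/-- The value of a morphism at a natural number, truncated to the source. -/
def natVal {x y : SimplexCategory} (f : x ⟶ y) (i : ℕ) : ℕ :=
  f.toOrderHom ⟨min i x.len, by omega⟩

lemma natVal_eq {x y : SimplexCategory} (f : x ⟶ y) (i : Fin (x.len + 1)) :
    natVal f i = f.toOrderHom i := by
  have : (⟨min (i : ℕ) x.len, by omega⟩ : Fin (x.len + 1)) = i := by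
    ext; simp; omega
  simp only [natVal, this]

lemma natVal_le {x y : SimplexCategory} (f : x ⟶ y) (i : ℕ) : natVal f i ≤ y.len :=
  Nat.le_of_lt_succ (f.toOrderHom _).isLt

lemma natVal_mono {x y : SimplexCategory} (f : x ⟶ y) {i j : ℕ} (h : i ≤ j) :
    natVal f i ≤ natVal f j :=
  f.toOrderHom.monotone (by simp only [Fin.mk_le_mk]; omega)

lemma natVal_comp {x y z : SimplexCategory} (f : x ⟶ y) (g : y ⟶ z) (i : ℕ) :
    natVal (f ≫ g) i = natVal g (natVal f i) :=
  (natVal_eq g (f.toOrderHom ⟨min i x.len, by omega⟩)).symm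

lemma hom_ext_natVal {x y : SimplexCategory} {f g : x ⟶ y}
    (h : ∀ i ≤ x.len, natVal f i = natVal g i) : f = g := by
  refine SimplexCategory.Hom.ext _ _ (OrderHom.ext _ _ (funext fun i => Fin.ext ?_))
  rw [← natVal_eq f i, ← natVal_eq g i]
  exact h i (by omega)

/-- The morphism given by a function on natural numbers which is monotone on the source. -/
def ofNatFun (x y : SimplexCategory) (φ : ℕ → ℕ)
    (hm : ∀ i j, i ≤ j → j ≤ x.len → φ i ≤ φ j) (hb : φ x.len ≤ y.len) : x ⟶ y :=
  SimplexCategory.Hom.mk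
    { toFun := fun i => ⟨φ i, Nat.lt_succ_of_le
        ((hm i x.len (by omega) le_rfl).trans hb)⟩
      monotone' := fun i j h => hm i j h (by omega) }

lemma natVal_ofNatFun (x y : SimplexCategory) (φ : ℕ → ℕ) (hm) (hb) {i : ℕ} (hi : i ≤ x.len) :
    natVal (ofNatFun x y φ hm hb) i = φ i := by
  change φ (min i x.len) = φ i
  rw [min_eq_left hi]

/-- The inert map `i ↦ a + i`. -/
def shift (a : ℕ) (x y : SimplexCategory) (h : a + x.len ≤ y.len) : x ⟶ y :=
  ofNatFun x y (fun i => a + i) (by intros; omega) h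

lemma natVal_shift {a : ℕ} {x y : SimplexCategory} (h : a + x.len ≤ y.len) {i : ℕ}
    (hi : i ≤ x.len) : natVal (shift a x y h) i = a + i :=
  natVal_ofNatFun _ _ _ _ _ hi

lemma shift_comp_shift {a b c : ℕ} {x y z : SimplexCategory} (h : a + x.len ≤ y.len)
    (h' : b + y.len ≤ z.len) (hc : c = a + b) :
    shift a x y h ≫ shift b y z h' = shift c x z (by omega) :=
  hom_ext_natVal fun i hi => by
    rw [natVal_comp, natVal_shift h hi, natVal_shift _ hi, natVal_shift h' (by omega)]
    omega

lemma isIso_shift {x y : SimplexCategory} (h : x.len = y.len) :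
    IsIso (shift 0 x y (by omega)) := by
  refine ⟨shift 0 y x (by omega), ?_, ?_⟩ <;>
  · rw [shift_comp_shift _ _ rfl]
    refine hom_ext_natVal fun i hi => ?_
    rw [natVal_shift _ hi]
    simp only [natVal, SimplexCategory.id_toOrderHom, OrderHom.id_coe, id_eq]
    omega

lemma δ_zero_eq_shift (n : ℕ) :
    SimplexCategory.δ (0 : Fin (n + 2)) = shift 1 ⦋n⦌ ⦋n + 1⦌ (by simp; omega) :=
  hom_ext_natVal fun i hi => by
    rw [natVal_shift _ hi, natVal]
    change ((Fin.succAbove (0 : Fin (n + 2)) ⟨min i n, by omega⟩ : Fin (n + 2)) : ℕ) = _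
    have hi' : i ≤ n := hi
    simp; omega

lemma δ_last_eq_shift (n : ℕ) :
    SimplexCategory.δ (Fin.last (n + 1)) = shift 0 ⦋n⦌ ⦋n + 1⦌ (by simp) :=
  hom_ext_natVal fun i hi => by
    rw [natVal_shift _ hi, natVal]
    change ((Fin.succAbove (Fin.last (n + 1)) ⟨min i n, by omega⟩ : Fin (n + 2)) : ℕ) = _
    have hi' : i ≤ n := hi
    simp; omega

end SimplexCategory

open SimplexCategory

lemma IsInert.natVal_eq_add {x y : SimplexCategory} {f : x ⟶ y} (hf : IsInert f) {i : ℕ}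
    (hi : i ≤ x.len) : natVal f i = natVal f 0 + i := by
  induction i with
  | zero => rfl
  | succ i ih =>
    have h := hf ⟨i, hi⟩
    rw [← natVal_eq, ← natVal_eq] at h
    simp only [Fin.val_succ, Fin.val_castSucc] at h
    rw [h, ih (by omega)]
    omega

lemma IsActive.natVal_zero {x y : SimplexCategory} {g : x ⟶ y} (hg : IsActive g) :
    natVal g 0 = 0 := by
  have h := natVal_eq g 0
  rw [hg.1] at h
  exact h

lemma IsActive.natVal_len {x y : SimplexCategory} {g : x ⟶ y} (hg : IsActive g) :
    natVal g x.len = y.len := by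
  have h := natVal_eq g (Fin.last x.len)
  rw [hg.2] at h
  exact h

/-! ### Pushouts of active maps along inert maps -/

/-- The extension of an active map `n ⟶ k` by the identity, on `a` steps below and the
remaining steps above. -/
def activeExtension {n k : SimplexCategory} (g : n ⟶ k) (a : ℕ) (m p : SimplexCategory)
    (hm : a + n.len ≤ m.len) (hp : p.len + n.len = m.len + k.len) : m ⟶ p :=
  ofNatFun m p
    (fun i => if i < a then i else if i ≤ a + n.len then a + natVal g (i - a)
      else i - n.len + k.len)
    (fun i j hij hj => by
      have h₁ := natVal_mono g (show i - a ≤ j - a by omega)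
      have h₂ := natVal_le g (i - a)
      split_ifs <;> omega)
    (by
      have h₂ := natVal_le g (m.len - a)
      split_ifs <;> omega)

section activeExtension

variable {n k m p : SimplexCategory} (g : n ⟶ k) {a : ℕ} (hm : a + n.len ≤ m.len)
  (hp : p.len + n.len = m.len + k.len)

lemma natVal_activeExtension {i : ℕ} (hi : i ≤ m.len) :
    natVal (activeExtension g a m p hm hp) i = if i < a then i else
      if i ≤ a + n.len then a + natVal g (i - a) else i - n.len + k.len :=
  natVal_ofNatFun _ _ _ _ _ hi

lemma shift_comp_activeExtension :
    shift a n m hm ≫ activeExtension g a m p hm hp = g ≫ shift a k p (by omega) :=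
  hom_ext_natVal fun i hi => by
    rw [natVal_comp, natVal_comp, natVal_shift _ hi, natVal_shift _ (natVal_le _ _),
      natVal_activeExtension _ _ _ (by omega), if_neg (by omega), if_pos (by omega)]
    congr 2; omega

lemma shift_zero_comp_activeExtension (hg : IsActive g) {c : SimplexCategory} (hc : c.len = a) :
    shift 0 c m (by omega) ≫ activeExtension g a m p hm hp = shift 0 c p (by omega) :=
  hom_ext_natVal fun i hi => by
    rw [natVal_comp, natVal_shift _ hi, natVal_shift _ hi,
      natVal_activeExtension _ _ _ (by omega)]
    have h₀ := hg.natVal_zero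
    split_ifs
    · rfl
    · rw [show 0 + i - a = 0 by omega]; omega
    · omega

lemma shift_add_comp_activeExtension (hg : IsActive g) {c : SimplexCategory}
    (hc : a + n.len + c.len = m.len) :
    shift (a + n.len) c m (by omega) ≫ activeExtension g a m p hm hp =
      shift (a + k.len) c p (by omega) :=
  hom_ext_natVal fun i hi => by
    rw [natVal_comp, natVal_shift _ hi, natVal_shift _ hi,
      natVal_activeExtension _ _ _ (by omega)]
    have h₀ := hg.natVal_len
    split_ifs
    · omega
    · rw [show a + n.len + i - a = n.len by omega]; omega
    · omega

/-- A cocone on an active map and an inert map, glued to a morphism out of the explicit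
pushout. -/
def activeExtensionDesc (hg : IsActive g) {q : SimplexCategory} (u : m ⟶ q) (v : k ⟶ q)
    (huv : shift a n m hm ≫ u = g ≫ v) : p ⟶ q :=
  ofNatFun p q
    (fun j => if j < a then natVal u j else if j ≤ a + k.len then natVal v (j - a)
      else natVal u (j - k.len + n.len))
    (by
      have e : ∀ i ≤ n.len, natVal u (a + i) = natVal v (natVal g i) := fun i hi => by
        rw [← natVal_comp, ← huv, natVal_comp, natVal_shift _ hi]
      have e₀ := e 0 (by omega)
      have e₁ := e n.len le_rfl
      rw [hg.natVal_zero] at e₀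
      rw [hg.natVal_len] at e₁
      intro i j hij hj
      split_ifs
      · exact natVal_mono u hij
      · exact (natVal_mono u (show i ≤ a + 0 by omega)).trans
          (e₀.le.trans (natVal_mono v (by omega)))
      · exact natVal_mono u (by omega)
      · omega
      · exact natVal_mono v (by omega)
      · exact (natVal_mono v (show i - a ≤ k.len by omega)).trans
          (e₁.symm.le.trans (natVal_mono u (by omega)))
      · omega
      · omega
      · exact natVal_mono u (by omega))
    (by split_ifs <;> exact natVal_le _ _)

lemma natVal_activeExtensionDesc (hg : IsActive g) {q : SimplexCategory} (u : m ⟶ q) (v : k ⟶ q)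
    (huv : shift a n m hm ≫ u = g ≫ v) {j : ℕ} (hj : j ≤ p.len) :
    natVal (activeExtensionDesc (p := p) g hm hg u v huv) j = if j < a then natVal u j else
      if j ≤ a + k.len then natVal v (j - a) else natVal u (j - k.len + n.len) :=
  natVal_ofNatFun _ _ _ _ _ hj

lemma isPushout_activeExtension (hg : IsActive g) :
    IsPushout (shift a n m hm) g (activeExtension g a m p hm hp) (shift a k p (by omega)) := by
  refine ⟨⟨shift_comp_activeExtension g hm hp⟩, ⟨PushoutCocone.IsColimit.mk _
    (fun t => activeExtensionDesc g hm hg t.inl t.inr t.condition) ?_ ?_ ?_⟩⟩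
  · intro t
    refine hom_ext_natVal fun i hi => ?_
    rw [natVal_comp, natVal_activeExtensionDesc _ _ _ _ _ _ (natVal_le _ _),
      natVal_activeExtension _ _ _ hi]
    have h := natVal_le g (i - a)
    by_cases h₁ : i < a
    · rw [if_pos h₁, if_pos h₁]
    · by_cases h₂ : i ≤ a + n.len
      · rw [if_neg h₁, if_pos h₂, if_neg (by omega), if_pos (by omega), Nat.add_sub_cancel_left,
          ← natVal_comp, ← t.condition, natVal_comp, natVal_shift _ (by omega)]
        congr 1; omega
      · rw [if_neg h₁, if_neg h₂, if_neg (by omega), if_neg (by omega)]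
        congr 1; omega
  · intro t
    refine hom_ext_natVal fun i hi => ?_
    rw [natVal_comp, natVal_shift _ hi, natVal_activeExtensionDesc _ _ _ _ _ _ (by omega),
      if_neg (by omega), if_pos (by omega), Nat.add_sub_cancel_left]
  · intro t w hl hr
    refine hom_ext_natVal fun j hj => ?_
    rw [natVal_activeExtensionDesc _ _ _ _ _ _ hj]
    split_ifs with h₁ h₂
    · rw [← hl, natVal_comp, natVal_activeExtension _ _ _ (by omega), if_pos h₁]
    · rw [← hr, natVal_comp, natVal_shift _ (by omega)]
      congr 1; omega
    · rw [← hl, natVal_comp, natVal_activeExtension _ _ _ (by omega), if_neg (by omega),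
        if_neg (by omega)]
      congr 1; omega

end activeExtension

/-! ### Segal objects -/

namespace IsSegal

variable {X : SimplicialObject C}

lemma isPullback_shift_one_one (hX : IsSegal X) {c x y z : SimplexCategory}
    (hx : x.len = c.len + 1) (hy : y.len = c.len + 1) (hz : z.len = c.len + 2) :
    IsPullback (X.map (shift 1 y z (by omega)).op) (X.map (shift 0 x z (by omega)).op)
      (X.map (shift 0 c y (by omega)).op) (X.map (shift 1 c x (by omega)).op) := by
  obtain rfl : x = ⦋c.len + 1⦌ := SimplexCategory.ext hx
  obtain rfl : y = ⦋c.len + 1⦌ := SimplexCategory.ext hy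
  obtain rfl : z = ⦋c.len + 2⦌ := SimplexCategory.ext hz
  have h := hX c.len
  simp only [SimplicialObject.δ, δ_zero_eq_shift] at h
  rw [δ_last_eq_shift, δ_last_eq_shift] at h
  exact h

lemma isPullback_shift_one (hX : IsSegal X) (b : ℕ) {c x y z : SimplexCategory}
    (hx : x.len = c.len + 1) (hy : y.len = c.len + b) (hz : z.len = c.len + 1 + b) :
    IsPullback (X.map (shift 1 y z (by omega)).op) (X.map (shift 0 x z (by omega)).op)
      (X.map (shift 0 c y (by omega)).op) (X.map (shift 1 c x (by omega)).op) := by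
  induction b generalizing y z with
  | zero =>
    have := isIso_shift (x := c) (y := y) (by omega)
    have := isIso_shift (x := x) (y := z) (by omega)
    refine IsPullback.of_vert_isIso ⟨?_⟩
    rw [← X.map_comp, ← X.map_comp, ← op_comp, ← op_comp, shift_comp_shift _ _ rfl,
      shift_comp_shift _ _ rfl]
  | succ b ih =>
    have h := (hX.isPullback_shift_one_one (c := ⦋c.len + b⦌) (x := ⦋c.len + 1 + b⦌)
      (y := y) (z := z) (by simp; omega) (by simp; omega) (by simp; omega)).paste_vert
      (ih (y := ⦋c.len + b⦌) (z := ⦋c.len + 1 + b⦌) (by simp) (by simp))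
    simpa only [← X.map_comp, ← op_comp, shift_comp_shift (hc := (Nat.zero_add 0).symm)] using h

lemma isPullback_shift (hX : IsSegal X) (a b : ℕ) {c x y z : SimplexCategory}
    (hx : x.len = c.len + a) (hy : y.len = c.len + b) (hz : z.len = c.len + a + b) :
    IsPullback (X.map (shift a y z (by omega)).op) (X.map (shift 0 x z (by omega)).op)
      (X.map (shift 0 c y (by omega)).op) (X.map (shift a c x (by omega)).op) := by
  induction a generalizing x z with
  | zero =>
    have := isIso_shift (x := c) (y := x) (by omega)
    have := isIso_shift (x := y) (y := z) (by omega)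
    refine IsPullback.of_horiz_isIso ⟨?_⟩
    rw [← X.map_comp, ← X.map_comp, ← op_comp, ← op_comp, shift_comp_shift _ _ rfl,
      shift_comp_shift _ _ rfl]
  | succ a ih =>
    have h := (hX.isPullback_shift_one b (c := ⦋c.len + a⦌) (x := x)
      (y := ⦋c.len + a + b⦌) (z := z) (by simp; omega) (by simp) (by simp; omega)).paste_horiz
      (ih (x := ⦋c.len + a⦌) (z := ⦋c.len + a + b⦌) (by simp) (by simp))
    simpa only [← X.map_comp, ← op_comp, shift_comp_shift (hc := (rfl : a + 1 = a + 1))] using h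

/-- The square extending an active map at the top is sent to a pullback. -/
lemma isPullback_extend_top (hX : IsSegal X) {n k m p : SimplexCategory} {g : n ⟶ k}
    (hg : IsActive g) (hm : n.len ≤ m.len) (hp : p.len + n.len = m.len + k.len) :
    IsPullback (X.map (activeExtension g 0 m p (by omega) hp).op)
      (X.map (shift 0 k p (by omega)).op) (X.map (shift 0 n m (by omega)).op) (X.map g.op) := by
  have hr := hX.isPullback_shift (c := ⦋0⦌) n.len (m.len - n.len) (x := n)
    (y := ⦋m.len - n.len⦌) (z := m) (by simp) (by simp) (by simp; omega)
  have ho := hX.isPullback_shift (c := ⦋0⦌) k.len (m.len - n.len) (x := k)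
    (y := ⦋m.len - n.len⦌) (z := p) (by simp) (by simp) (by simp; omega)
  refine IsPullback.of_right ?_ ?_ hr
  · have e₁ : shift n.len ⦋m.len - n.len⦌ m (by simp; omega) ≫
        activeExtension g 0 m p (by omega) hp =
        shift k.len ⦋m.len - n.len⦌ p (by simp; omega) := by
      simpa using shift_add_comp_activeExtension g (a := 0) (by omega) hp hg
        (c := ⦋m.len - n.len⦌) (by simp; omega)
    have e₂ : shift n.len ⦋0⦌ n (by simp) ≫ g = shift k.len ⦋0⦌ k (by simp) :=
      hom_ext_natVal fun i hi => by
        obtain rfl : i = 0 := by simpa using hi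
        rw [natVal_comp, natVal_shift _ hi, natVal_shift _ hi]
        exact hg.natVal_len
    rw [← X.map_comp, ← X.map_comp, ← op_comp, ← op_comp, e₁, e₂]
    exact ho
  · rw [← X.map_comp, ← X.map_comp, ← op_comp, ← op_comp, shift_comp_activeExtension]

/-- The square extending an active map at the bottom is sent to a pullback. -/
lemma isPullback_extend_bot (hX : IsSegal X) {n k m p : SimplexCategory} {g : n ⟶ k}
    (hg : IsActive g) {a : ℕ} (hm : a + n.len = m.len) (hp : p.len + n.len = m.len + k.len) :
    IsPullback (X.map (activeExtension g a m p hm.le hp).op)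
      (X.map (shift a k p (by omega)).op) (X.map (shift a n m hm.le).op) (X.map g.op) := by
  have hr := (hX.isPullback_shift (c := ⦋0⦌) a n.len (x := ⦋a⦌)
    (y := n) (z := m) (by simp) (by simp) (by simp; omega)).flip
  have ho := (hX.isPullback_shift (c := ⦋0⦌) a k.len (x := ⦋a⦌)
    (y := k) (z := p) (by simp) (by simp) (by simp; omega)).flip
  refine IsPullback.of_right ?_ ?_ hr
  · have e₂ : shift 0 ⦋0⦌ n (by simp) ≫ g = shift 0 ⦋0⦌ k (by simp) :=
      hom_ext_natVal fun i hi => by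
        obtain rfl : i = 0 := by simpa using hi
        rw [natVal_comp, natVal_shift _ hi, natVal_shift _ hi]
        exact hg.natVal_zero
    rw [← X.map_comp, ← X.map_comp, ← op_comp, ← op_comp,
      shift_zero_comp_activeExtension g hm.le hp hg (c := ⦋a⦌) (by simp), e₂]
    exact ho
  · rw [← X.map_comp, ← X.map_comp, ← op_comp, ← op_comp, shift_comp_activeExtension]

end IsSegal

lemma isActive_activeExtension {n k m p : SimplexCategory} {g : n ⟶ k} (hg : IsActive g) {a : ℕ}
    (hm : a + n.len ≤ m.len) (hp : p.len + n.len = m.len + k.len) :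
    IsActive (activeExtension g a m p hm hp) := by
  have h₀ := hg.natVal_zero
  have h₁ := hg.natVal_len
  constructor <;> apply Fin.ext <;> rw [← natVal_eq, natVal_activeExtension _ _ _ (by simp)]
  · simp only [Fin.val_zero, Nat.zero_sub, h₀]
    split_ifs <;> omega
  · simp only [Fin.val_last]
    split_ifs
    · omega
    · rw [show m.len - a = n.len by omega]; omega
    · omega

lemma activeExtension_activeExtension {n k m p m' p' : SimplexCategory} {g : n ⟶ k} {a : ℕ}
    (hm : a + n.len = m'.len) (hp : p'.len + n.len = m'.len + k.len)
    (hm' : 0 + m'.len ≤ m.len) (hp' : p.len + m'.len = m.len + p'.len) :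
    activeExtension (activeExtension g a m' p' hm.le hp) 0 m p hm' hp' =
      activeExtension g a m p (by omega) (by omega) :=
  hom_ext_natVal fun i hi => by
    rw [natVal_activeExtension _ _ _ hi, natVal_activeExtension _ _ _ hi, if_neg (by omega)]
    by_cases h : i ≤ m'.len
    · rw [if_pos (by omega), natVal_activeExtension _ _ _ (by omega), Nat.sub_zero, Nat.zero_add]
    · rw [if_neg (by omega), if_neg (by omega), if_neg (by omega)]
      omega

lemma IsSegal.isPullback_activeExtension {X : SimplicialObject C} (hX : IsSegal X)
    {n k m p : SimplexCategory} {g : n ⟶ k} (hg : IsActive g) {a : ℕ}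
    (hm : a + n.len ≤ m.len) (hp : p.len + n.len = m.len + k.len) :
    IsPullback (X.map (activeExtension g a m p hm hp).op) (X.map (shift a k p (by omega)).op)
      (X.map (shift a n m hm).op) (X.map g.op) := by
  let m' : SimplexCategory := ⦋a + n.len⦌
  let p' : SimplexCategory := ⦋a + k.len⦌
  have hm' : a + n.len = m'.len := rfl
  have hp' : p'.len + n.len = m'.len + k.len := by grind
  have hp'' : p.len + m'.len = m.len + p'.len := by grind
  have h := (hX.isPullback_extend_top (isActive_activeExtension hg hm'.le hp')
    (m := m) (p := p) (by omega) hp'').paste_vert (hX.isPullback_extend_bot hg hm' hp')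
  simpa only [← X.map_comp, ← op_comp, shift_comp_shift (hc := (Nat.add_zero a).symm),
    activeExtension_activeExtension hm' hp' _ hp''] using h

/-- Every Segal object is a decomposition object. -/
theorem isDecomp_of_isSegal (X : SimplicialObject C) (hX : IsSegal X) : IsDecomp X := by
  intro n m k p f g r s hf hg h
  have hm : natVal f 0 + n.len ≤ m.len := by
    rw [← hf.natVal_eq_add le_rfl]
    exact natVal_le f _
  have hf' : f = shift (natVal f 0) n m hm :=
    hom_ext_natVal fun i hi => by rw [hf.natVal_eq_add hi, natVal_shift _ hi]
  have hp : (⦋m.len - n.len + k.len⦌ : SimplexCategory).len + n.len = m.len + k.len := by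
    simp; omega
  have h₁ := isPushout_activeExtension g hm hp hg
  have h₂ := hX.isPullback_activeExtension hg hm hp
  rw [← hf'] at h₁ h₂
  refine h₂.of_iso (X.mapIso (h.isoIsPushout _ _ h₁).op) (Iso.refl _) (Iso.refl _) (Iso.refl _)
    ?_ ?_ ?_ ?_
  · simp [← X.map_comp, ← op_comp]
  · simp [← X.map_comp, ← op_comp]
  · simp
  · simp
end

section
/- Let X be a decomposition object in a category C. Then every degeneracy map of X is a pullback of s_0 : X_0 → X_1: for each 0 ≤ j ≤ n, the square with left edge s_j : X_n → X_{n+1}, right edge s_0 : X_0 → X_1, top edge X_n → X_0 induced by the inert map [0] → [n] with image {j}, and bottom edge X_{n+1} → X_1 induced by the inert map [1] → [n+1] with image {j, j+1}, is a pullback. Moreover every inner face map of X is a pullback of d_1 : X_2 → X_1: for each 0 < i < n, the square with left edge d_i : X_n → X_{n−1}, right edge d_1 : X_2 → X_1, top edge X_n → X_2 induced by the inert map [2] → [n] with image {i−1, i, i+1}, and bottom edge X_{n−1} → X_1 induced by the inert map [1] → [n−1] with image {i−1, i}, is a pullback. -/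
open CategoryTheory CategoryTheory.Limits Simplicial Opposite

variable {C : Type*} [Category C]

namespace SimplexCategory

lemma subinterval_apply_val {n : ℕ} (j l : ℕ) (h : j + l ≤ n) (x : Fin (l + 1)) :
    ((subinterval (n := n) j l h).toOrderHom x : ℕ) = x + j := rfl

lemma δ_apply_val {n : ℕ} (i : Fin (n + 2)) (x : Fin (n + 1)) :
    ((δ i).toOrderHom x : ℕ) = if (x : ℕ) < i then (x : ℕ) else x + 1 := by
  change ((i.succAbove x : Fin (n + 2)) : ℕ) = _
  simp only [Fin.succAbove, Fin.lt_def, Fin.val_castSucc]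
  split_ifs <;> rfl

lemma σ_apply_val {n : ℕ} (i : Fin (n + 1)) (x : Fin (n + 2)) :
    ((σ i).toOrderHom x : ℕ) = if (i : ℕ) < x then (x : ℕ) - 1 else x := by
  change ((i.predAbove x : Fin (n + 1)) : ℕ) = _
  simp only [Fin.predAbove, Fin.lt_def, Fin.val_castSucc]
  split_ifs <;> rfl

lemma hom_ext_val {x y : SimplexCategory} {f g : x ⟶ y}
    (h : ∀ i, (f.toOrderHom i : ℕ) = g.toOrderHom i) : f = g :=
  Hom.ext _ _ (OrderHom.ext _ _ (funext fun i => Fin.ext (h i)))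

lemma comp_apply {x y z : SimplexCategory} (f : x ⟶ y) (g : y ⟶ z) (i : Fin (x.len + 1)) :
    (f ≫ g).toOrderHom i = g.toOrderHom (f.toOrderHom i) := rfl

/-- A commutative square in `Δ` whose two maps into the corner are jointly surjective is a
pushout as soon as every cocone factors through the corner. -/
lemma isPushout_of_jointly_surjective_s9 {n m k p : SimplexCategory}
    {f : n ⟶ m} {g : n ⟶ k} {r : m ⟶ p} {s : k ⟶ p} (w : f ≫ r = g ≫ s)
    (surj : ∀ y : Fin (p.len + 1), (∃ x, r.toOrderHom x = y) ∨ ∃ x, s.toOrderHom x = y)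
    (desc : ∀ {y : SimplexCategory} (a : m ⟶ y) (b : k ⟶ y), f ≫ a = g ≫ b →
      ∃ c : p ⟶ y, r ≫ c = a ∧ s ≫ c = b) :
    IsPushout f g r s := by
  choose c hr hs using fun t : PushoutCocone f g => desc t.inl t.inr t.condition
  refine ⟨⟨w⟩, ⟨PushoutCocone.IsColimit.mk w c hr hs fun t d h₁ h₂ => ?_⟩⟩
  refine Hom.ext _ _ (OrderHom.ext _ _ (funext fun y => ?_))
  rcases surj y with ⟨x, rfl⟩ | ⟨x, rfl⟩
  · rw [← comp_apply, ← comp_apply, h₁, hr]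
  · rw [← comp_apply, ← comp_apply, h₂, hs]

lemma isInert_subinterval {n : ℕ} (j l : ℕ) (h : j + l ≤ n) :
    IsInert (subinterval (n := n) j l h) := fun i => by
  rw [subinterval_apply_val, subinterval_apply_val, Fin.val_succ, Fin.val_castSucc]
  omega

lemma isPushout_σ (n : ℕ) (j : Fin (n + 1)) (h₁ : (j : ℕ) + 1 ≤ n + 1) (h₀ : (j : ℕ) + 0 ≤ n) :
    IsPushout (subinterval (n := n + 1) j 1 h₁) (σ (0 : Fin 1)) (σ j)
      (subinterval (n := n) j 0 h₀) := by
  have hj := j.is_lt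
  refine isPushout_of_jointly_surjective_s9 ?_ ?_ ?_
  · refine hom_ext_val fun (x : Fin 2) => ?_
    rw [comp_apply, comp_apply, σ_apply_val, subinterval_apply_val, subinterval_apply_val,
      σ_apply_val]
    fin_cases x <;> simp
  · intro (y : Fin (n + 1))
    refine Or.inl ⟨(δ j.castSucc).toOrderHom y, ?_⟩
    rw [← comp_apply, δ_comp_σ_self]
    rfl
  · intro y a b hab
    have key (x : Fin 2) : a.toOrderHom ((subinterval (n := n + 1) j 1 h₁).toOrderHom x) =
        b.toOrderHom (0 : Fin 1) := by
      rw [← comp_apply, hab, comp_apply]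
      exact congrArg _ (Subsingleton.elim (α := Fin 1) _ _)
    refine ⟨δ j.castSucc ≫ a, ?_, ?_⟩
    · refine hom_ext_val fun (x : Fin (n + 2)) => congrArg Fin.val ?_
      rw [comp_apply, comp_apply]
      by_cases hx : (x : ℕ) = j
      · trans a.toOrderHom ((subinterval (n := n + 1) j 1 h₁).toOrderHom (1 : Fin 2))
        · refine congrArg _ (Fin.ext ?_)
          rw [δ_apply_val, σ_apply_val, subinterval_apply_val]
          simp [hx, add_comm]
        · rw [key, ← key (0 : Fin 2)]
          refine congrArg _ (Fin.ext ?_)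
          rw [subinterval_apply_val]
          simp [hx]
      · refine congrArg _ (Fin.ext ?_)
        rw [δ_apply_val, σ_apply_val, Fin.val_castSucc]
        split_ifs <;> omega
    · refine hom_ext_val fun (x : Fin 1) => congrArg Fin.val ?_
      obtain rfl := Subsingleton.elim x 0
      rw [← key (1 : Fin 2), comp_apply, comp_apply]
      refine congrArg _ (Fin.ext ?_)
      rw [δ_apply_val, subinterval_apply_val, subinterval_apply_val]
      simp [add_comm]

lemma isPushout_δ (m i : ℕ) (hi : i + 1 < m + 2) (h₁ : i + 1 ≤ m + 1) (h₂ : i + 2 ≤ m + 2)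
    (h : i + 1 < m + 3) :
    IsPushout (subinterval (n := m + 1) i 1 h₁) (δ (1 : Fin 3)) (δ (⟨i + 1, h⟩ : Fin (m + 3)))
      (subinterval (n := m + 2) i 2 h₂) := by
  refine isPushout_of_jointly_surjective_s9 ?_ ?_ ?_
  · refine hom_ext_val fun (x : Fin 2) => ?_
    rw [comp_apply, comp_apply, δ_apply_val, subinterval_apply_val, subinterval_apply_val,
      δ_apply_val]
    fin_cases x <;> simp <;> omega
  · intro (y : Fin (m + 3))
    by_cases hy : y = ⟨i + 1, h⟩
    · refine Or.inr ⟨(1 : Fin 3), Fin.ext ?_⟩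
      rw [subinterval_apply_val, hy]
      simp [add_comm]
    · exact Or.inl (Fin.exists_succAbove_eq hy)
  · intro y a b hab
    have key (x : Fin 2) : a.toOrderHom ((subinterval (n := m + 1) i 1 h₁).toOrderHom x) =
        b.toOrderHom ((δ (1 : Fin 3)).toOrderHom x) := by
      rw [← comp_apply, hab, comp_apply]
    have key₀ : a.toOrderHom (⟨i, by omega⟩ : Fin (m + 2)) = b.toOrderHom (0 : Fin 3) := by
      refine Eq.trans (congrArg _ (Fin.ext ?_)) (key (0 : Fin 2))
      rw [subinterval_apply_val]
      simp
    have key₂ : a.toOrderHom (⟨i + 1, by omega⟩ : Fin (m + 2)) = b.toOrderHom (2 : Fin 3) := by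
      refine Eq.trans (congrArg _ (Fin.ext ?_)) (key (1 : Fin 2))
      rw [subinterval_apply_val]
      simp [add_comm]
    have hle {x z : ℕ} (hx : x < m + 2) (hz : z < m + 2) (hxz : x ≤ z) :
        a.toOrderHom (⟨x, hx⟩ : Fin (m + 2)) ≤ a.toOrderHom (⟨z, hz⟩ : Fin (m + 2)) :=
      a.toOrderHom.monotone hxz
    have hb₁ : b.toOrderHom (0 : Fin 3) ≤ b.toOrderHom (1 : Fin 3) :=
      b.toOrderHom.monotone (show (0 : Fin 3) ≤ 1 by decide)
    have hb₂ : b.toOrderHom (1 : Fin 3) ≤ b.toOrderHom (2 : Fin 3) :=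
      b.toOrderHom.monotone (show (1 : Fin 3) ≤ 2 by decide)
    let c : Fin (m + 3) →o Fin (y.len + 1) :=
      { toFun := fun x =>
          if hx : (x : ℕ) < i + 1 then a.toOrderHom (⟨x, by omega⟩ : Fin (m + 2))
          else if (x : ℕ) = i + 1 then b.toOrderHom (1 : Fin 3)
          else a.toOrderHom (⟨x - 1, by omega⟩ : Fin (m + 2))
        monotone' := fun x z hxz => by
          have hxz' : (x : ℕ) ≤ z := hxz
          dsimp only
          split_ifs
          · exact hle _ _ hxz'
          · exact (hle _ _ (by omega)).trans (key₀.trans_le hb₁)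
          · exact hle _ _ (by omega)
          · omega
          · exact le_rfl
          · exact (hb₂.trans_eq key₂.symm).trans (hle _ _ (by omega))
          · omega
          · omega
          · exact hle _ _ (by omega) }
    have hc (x : Fin (m + 3)) : (Hom.mk c : ⦋m + 2⦌ ⟶ y).toOrderHom x =
          if hx : (x : ℕ) < i + 1 then a.toOrderHom (⟨x, by omega⟩ : Fin (m + 2))
          else if (x : ℕ) = i + 1 then b.toOrderHom (1 : Fin 3)
          else a.toOrderHom (⟨x - 1, by omega⟩ : Fin (m + 2)) := rfl
    refine ⟨Hom.mk c, ?_, ?_⟩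
    · refine hom_ext_val fun (x : Fin (m + 2)) => congrArg Fin.val ?_
      have hδ := δ_apply_val (⟨i + 1, h⟩ : Fin (m + 3)) x
      dsimp only at hδ
      rw [comp_apply, hc]
      split_ifs at hδ ⊢ <;> first | omega | exact congrArg _ (Fin.ext (by dsimp only; omega))
    · refine hom_ext_val fun (x : Fin 3) => congrArg Fin.val ?_
      have hx := subinterval_apply_val i 2 h₂ x
      rw [comp_apply, hc]
      fin_cases x <;> dsimp only at hx ⊢
      · rw [dif_pos (by omega)]
        exact Eq.trans (congrArg _ (Fin.ext (by dsimp only; omega))) key₀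
      · rw [dif_neg (by omega), if_pos (by omega)]
        rfl
      · rw [dif_neg (by omega), if_neg (by omega)]
        exact Eq.trans (congrArg _ (Fin.ext (by dsimp only; omega))) key₂

end SimplexCategory

/-- In a decomposition object `X`, every degeneracy map is a pullback of
`s_0 : X_0 ⟶ X_1` along the maps induced by the inert maps `[0] ⟶ [n]` with image
`{j}` and `[1] ⟶ [n+1]` with image `{j, j+1}`; and every inner face map is a pullback
of `d_1 : X_2 ⟶ X_1` along the maps induced by the inert maps `[2] ⟶ [n]` with image
`{i-1, i, i+1}` and `[1] ⟶ [n-1]` with image `{i-1, i}` (here `n = m+2`). -/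
theorem degeneracy_and_inner_face_are_pullbacks (X : SimplicialObject C)
    (hX : IsDecomp X) :
    (∀ (n : ℕ) (j : Fin (n + 1)),
      IsPullback
        (X.map (SimplexCategory.subinterval (n := n) (j : ℕ) 0
          (by have := j.is_lt; omega)).op)
        (X.σ j)
        (X.σ (0 : Fin 1))
        (X.map (SimplexCategory.subinterval (n := n + 1) (j : ℕ) 1
          (by have := j.is_lt; omega)).op)) ∧
    (∀ (m i : ℕ) (_ : 0 < i) (_ : i < m + 2),
      IsPullback
        (X.map (SimplexCategory.subinterval (n := m + 2) (i - 1) 2 (by omega)).op)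
        (X.δ (⟨i, by omega⟩ : Fin (m + 3)))
        (X.δ (1 : Fin 3))
        (X.map (SimplexCategory.subinterval (n := m + 1) (i - 1) 1 (by omega)).op)) := by
  refine ⟨fun n j => ?_, fun m i hi hi' => ?_⟩
  · exact (hX _ _ _ _ (SimplexCategory.isInert_subinterval _ _ _) ⟨rfl, rfl⟩
      (SimplexCategory.isPushout_σ n j _ _)).flip
  · obtain _ | i := i
    · omega
    exact (hX _ _ _ _ (SimplexCategory.isInert_subinterval _ _ _) ⟨rfl, rfl⟩
      (SimplexCategory.isPushout_δ m _ hi' _ _ _)).flip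
end

section
/- Let X be a decomposition object in a category C. Then, whenever the indicated face and degeneracy maps are defined: for all i < j the square with top edge d_j : X_{n+1} → X_n, left edge s_i : X_{n+1} → X_{n+2}, right edge s_i : X_n → X_{n+1}, and bottom edge d_{j+1} : X_{n+2} → X_{n+1} is a pullback; and for all j ≤ i the square with top edge d_j : X_{n+1} → X_n, left edge s_{i+1} : X_{n+1} → X_{n+2}, right edge s_i : X_n → X_{n+1}, and bottom edge d_j : X_{n+2} → X_{n+1} is a pullback. -/
open CategoryTheory CategoryTheory.Limits Simplicial Opposite

variable {C : Type*} [Category C]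

namespace SimplexCategory

/-- Collapsing the `i`-th principal edge of `⦋n + 1⦌` to a point gives `⦋n⦌`. -/
lemma isPushout_mkOfSucc_σ {n : ℕ} (i : Fin (n + 1)) :
    IsPushout (mkOfSucc i) (σ (0 : Fin 1)) (σ i) (const ⦋0⦌ ⦋n⦌ i) where
  w := by
    ext x : 3
    fin_cases x
    · exact Fin.predAbove_castSucc_self i
    · exact Fin.predAbove_succ_self i
  isColimit' := ⟨by
    refine PushoutCocone.IsColimit.mk _ (fun s => δ i.castSucc ≫ s.inl) (fun s => ?_)
      (fun s => ?_) (fun s m hm _ => ?_)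
    all_goals
      have h₀ : s.inl.toOrderHom i.castSucc = s.inr.toOrderHom 0 :=
        congrArg (fun f => f.toOrderHom 0) s.condition
      have h₁ : s.inl.toOrderHom i.succ = s.inr.toOrderHom 0 :=
        congrArg (fun f => f.toOrderHom 1) s.condition
    · ext x : 3
      change s.inl.toOrderHom (i.castSucc.succAbove (i.predAbove x)) = s.inl.toOrderHom x
      by_cases hx : x = i.castSucc
      · subst hx
        rw [Fin.predAbove_castSucc_self, Fin.succAbove_castSucc_self, h₀, h₁]
      · rw [Fin.succAbove_predAbove hx]
    · ext x : 3
      obtain rfl : x = (0 : Fin 1) := Subsingleton.elim (α := Fin 1) x 0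
      change s.inl.toOrderHom (i.castSucc.succAbove i) = s.inr.toOrderHom 0
      rw [Fin.succAbove_castSucc_self, h₁]
    · rw [← hm, ← Category.assoc, δ_comp_σ_self, Category.id_comp]⟩

end SimplexCategory

lemma isInert_mkOfSucc {n : ℕ} (i : Fin n) : IsInert (SimplexCategory.mkOfSucc i) := by
  intro x
  obtain rfl : x = (0 : Fin 1) := Subsingleton.elim (α := Fin 1) x 0
  rfl

lemma isActive_σ_zero : IsActive (SimplexCategory.σ (0 : Fin 1)) :=
  ⟨rfl, rfl⟩

namespace IsDecomp

variable {X : SimplicialObject C}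

/-- Every degeneracy of a decomposition object is a pullback of `s₀ : X₀ ⟶ X₁`. -/
lemma isPullback_const_σ (hX : IsDecomp X) {n : ℕ} (i : Fin (n + 1)) :
    IsPullback (X.map (SimplexCategory.const ⦋0⦌ ⦋n⦌ i).op) (X.σ i) (X.σ (0 : Fin 1))
      (X.map (SimplexCategory.mkOfSucc i).op) :=
  (hX _ _ _ _ (isInert_mkOfSucc i) isActive_σ_zero
    (SimplexCategory.isPushout_mkOfSucc_σ i)).flip

/-- A square relating two degeneracies is a pullback as soon as its bottom edge matches the
principal edges which they collapse. -/
lemma isPullback_σ (hX : IsDecomp X) {m n : ℕ} {i : Fin (m + 1)} {i' : Fin (n + 1)}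
    (φ : ⦋m⦌ ⟶ ⦋n⦌) (ψ : ⦋m + 1⦌ ⟶ ⦋n + 1⦌) (w : ψ ≫ SimplexCategory.σ i' = SimplexCategory.σ i ≫ φ)
    (hi : φ.toOrderHom i = i')
    (h : SimplexCategory.mkOfSucc i ≫ ψ = SimplexCategory.mkOfSucc i') :
    IsPullback (X.map φ.op) (X.σ i') (X.σ i) (X.map ψ.op) := by
  refine IsPullback.of_right ?_ ?_ (hX.isPullback_const_σ i)
  · rw [← X.map_comp, ← X.map_comp, ← op_comp, ← op_comp, h,
      SimplexCategory.const_comp, hi]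
    exact hX.isPullback_const_σ i'
  · simp only [SimplicialObject.σ, ← X.map_comp, ← op_comp, w]

end IsDecomp

/-- Bonus pullbacks: in a decomposition object `X`, for all `i < j` the square
`(d_j, s_i; s_i, d_{j+1})` is a pullback, and for all `j ≤ i` the square
`(d_j, s_{i+1}; s_i, d_j)` is a pullback (whenever the indicated maps are defined). -/
theorem bonus_pullbacks (X : SimplicialObject C) (hX : IsDecomp X) :
    (∀ (n i j : ℕ) (_ : i < j) (_ : j ≤ n + 1),
      IsPullback (X.δ (⟨j, by omega⟩ : Fin (n + 2))) (X.σ (⟨i, by omega⟩ : Fin (n + 2)))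
        (X.σ (⟨i, by omega⟩ : Fin (n + 1))) (X.δ (⟨j + 1, by omega⟩ : Fin (n + 3)))) ∧
    (∀ (n i j : ℕ) (_ : j ≤ i) (_ : i ≤ n),
      IsPullback (X.δ (⟨j, by omega⟩ : Fin (n + 2))) (X.σ (⟨i + 1, by omega⟩ : Fin (n + 2)))
        (X.σ (⟨i, by omega⟩ : Fin (n + 1))) (X.δ (⟨j, by omega⟩ : Fin (n + 3)))) := by
  refine ⟨fun n i j hij hj => ?_, fun n i j hji hi => ?_⟩
  · refine hX.isPullback_σ (SimplexCategory.δ _) (SimplexCategory.δ _) ?_ ?_ ?_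
    · exact SimplexCategory.δ_comp_σ_of_gt (i := ⟨j, by omega⟩) (j := ⟨i, by omega⟩) hij
    · exact Fin.succAbove_of_castSucc_lt _ _ hij
    · ext x : 3
      fin_cases x
      · exact Fin.succAbove_of_castSucc_lt _ _ (Nat.lt_succ_of_lt hij)
      · exact Fin.succAbove_of_castSucc_lt _ _ (Nat.succ_lt_succ hij)
  · refine hX.isPullback_σ (SimplexCategory.δ _) (SimplexCategory.δ _) ?_ ?_ ?_
    · exact SimplexCategory.δ_comp_σ_of_le (i := ⟨j, by omega⟩) (j := ⟨i, by omega⟩) hji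
    · exact Fin.succAbove_of_le_castSucc _ _ hji
    · ext x : 3
      fin_cases x
      · exact Fin.succAbove_of_le_castSucc _ _ hji
      · exact Fin.succAbove_of_le_castSucc _ _ (Nat.le_succ_of_le hji)
end

section
/- Any ULF simplicial map F : Y → X between decomposition objects in a category C is also conservative (and hence CULF): if F is cartesian on every inner coface map, then F is cartesian on every codegeneracy map, and therefore on every active map of Δ. -/
open CategoryTheory CategoryTheory.Limits Simplicial Opposite

variable {C : Type*} [Category C]

/-- A simplicial map is *ULF* if it is cartesian on every inner coface map. -/
def IsULF {X Y : SimplicialObject C} (F : Y ⟶ X) : Prop :=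
  ∀ (n i : ℕ) (_ : 0 < i) (hi : i < n + 1), CartesianOn F (SimplexCategory.δ (⟨i, by omega⟩ : Fin (n + 2)))

/-- A simplicial map is *conservative* if it is cartesian on every codegeneracy map. -/
def IsConservative {X Y : SimplicialObject C} (F : Y ⟶ X) : Prop :=
  ∀ (n : ℕ) (i : Fin (n + 1)), CartesianOn F (SimplexCategory.σ i)

/-- A simplicial map is *CULF* if it is cartesian on every active map of `Δ`. -/
def IsCULF {X Y : SimplicialObject C} (F : Y ⟶ X) : Prop :=
  ∀ ⦃x y : SimplexCategory⦄ (α : x ⟶ y), IsActive α → CartesianOn F α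

namespace CartesianOn

variable {X Y : SimplicialObject C} {F : Y ⟶ X}

theorem of_isIso (F : Y ⟶ X) {x y : SimplexCategory} (α : x ⟶ y) [IsIso α] :
    CartesianOn F α :=
  IsPullback.of_horiz_isIso ⟨F.naturality α.op⟩

theorem comp {x y z : SimplexCategory} {α : x ⟶ y} {β : y ⟶ z}
    (hα : CartesianOn F α) (hβ : CartesianOn F β) : CartesianOn F (α ≫ β) := by
  simpa only [CartesianOn, op_comp, Functor.map_comp] using IsPullback.paste_horiz hβ hα

theorem of_comp {x y z : SimplexCategory} {α : x ⟶ y} {β : y ⟶ z}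
    (hα : CartesianOn F α) (hαβ : CartesianOn F (α ≫ β)) : CartesianOn F β :=
  IsPullback.of_right (by simpa only [CartesianOn, op_comp, Functor.map_comp] using hαβ)
    (F.naturality β.op) hα

/-- The arrows on which a simplicial map is cartesian are closed under retracts. -/
theorem of_retract {x y x' y' : SimplexCategory} {α : x ⟶ y} {β : x' ⟶ y'}
    (i : x ⟶ x') (r : x' ⟶ x) (j : y ⟶ y') (q : y' ⟶ y) (hir : i ≫ r = 𝟙 x) (hjq : j ≫ q = 𝟙 y)
    (hi : i ≫ β = α ≫ j) (hr : r ≫ α = β ≫ q) (hβ : CartesianOn F β) : CartesianOn F α := by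
  have hi' (Z : SimplicialObject C) : Z.map j.op ≫ Z.map α.op = Z.map β.op ≫ Z.map i.op := by
    simp only [← Functor.map_comp, ← op_comp, hi]
  have hr' (Z : SimplicialObject C) : Z.map α.op ≫ Z.map r.op = Z.map q.op ≫ Z.map β.op := by
    simp only [← Functor.map_comp, ← op_comp, hr]
  have hir' (Z : SimplicialObject C) : Z.map r.op ≫ Z.map i.op = 𝟙 _ := by
    rw [← Functor.map_comp, ← op_comp, hir, op_id, CategoryTheory.Functor.map_id]
  have hjq' (Z : SimplicialObject C) : Z.map q.op ≫ Z.map j.op = 𝟙 _ := by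
    rw [← Functor.map_comp, ← op_comp, hjq, op_id, CategoryTheory.Functor.map_id]
  have hpb : IsPullback (Y.map β.op) (F.app (op y')) (F.app (op x')) (X.map β.op) := hβ
  have hw (s : PullbackCone (F.app (op x)) (X.map α.op)) :
      (s.fst ≫ Y.map r.op) ≫ F.app (op x') = (s.snd ≫ X.map q.op) ≫ X.map β.op := by
    rw [Category.assoc, Category.assoc, F.naturality, ← hr', reassoc_of% s.condition]
  refine ⟨⟨F.naturality α.op⟩, ⟨PullbackCone.IsLimit.mk _
    (fun s ↦ hpb.lift (s.fst ≫ Y.map r.op) (s.snd ≫ X.map q.op) (hw s) ≫ Y.map j.op)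
    (fun s ↦ ?_) (fun s ↦ ?_) (fun s m hfst hsnd ↦ ?_)⟩⟩
  · simp only [Category.assoc, hi', hpb.lift_fst_assoc, hir', Category.comp_id]
  · simp only [Category.assoc, F.naturality, hpb.lift_snd_assoc, hjq', Category.comp_id]
  · have : m ≫ Y.map q.op = hpb.lift (s.fst ≫ Y.map r.op) (s.snd ≫ X.map q.op) (hw s) := by
      apply hpb.hom_ext
      · rw [hpb.lift_fst, Category.assoc, ← hr', reassoc_of% hfst]
      · rw [hpb.lift_snd, Category.assoc, F.naturality, reassoc_of% hsnd]
    rw [← this, Category.assoc, hjq', Category.comp_id]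

end CartesianOn

namespace IsActive

theorem comp {x y z : SimplexCategory} {f : x ⟶ y} {g : y ⟶ z}
    (hf : IsActive f) (hg : IsActive g) : IsActive (f ≫ g) := by
  simp [IsActive, hf.1, hf.2, hg.1, hg.2]

theorem eq_of_one {y : SimplexCategory} {f g : ⦋1⦌ ⟶ y} (hf : IsActive f) (hg : IsActive g) :
    f = g := by
  ext i : 3
  fin_cases i
  · exact hf.1.trans hg.1.symm
  · exact hf.2.trans hg.2.symm

theorem δ_one (n : ℕ) : IsActive (SimplexCategory.δ (1 : Fin (n + 3))) := by
  constructor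
  · exact Fin.succAbove_ne_zero_zero (a := (1 : Fin (n + 3))) (by simp)
  · exact Fin.succAbove_ne_last_last (a := (1 : Fin (n + 3))) (by simp [Fin.ext_iff])

theorem σ {n : ℕ} (i : Fin (n + 1)) : IsActive (SimplexCategory.σ i) := by
  constructor
  · exact Fin.predAbove_right_zero (i := i)
  · exact Fin.predAbove_right_last (i := i)

/-- There is an active map from `⦋1⦌` to every object of the simplex category. -/
theorem exists_of_one (y : SimplexCategory) : ∃ f : ⦋1⦌ ⟶ y, IsActive f :=
  ⟨SimplexCategory.mkOfLe 0 (Fin.last y.len) (Fin.zero_le _), rfl, rfl⟩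

end IsActive

namespace IsULF

variable {X Y : SimplicialObject C} {F : Y ⟶ X}

theorem cartesianOn_δ_one (hF : IsULF F) (n : ℕ) :
    CartesianOn F (SimplexCategory.δ (1 : Fin (n + 3))) :=
  hF (n + 1) 1 (by omega) (by omega)

theorem cartesianOn_σ_zero (hF : IsULF F) : CartesianOn F (SimplexCategory.σ (0 : Fin 1)) := by
  refine .of_retract (β := SimplexCategory.σ (0 : Fin 2)) (SimplexCategory.δ 2)
    (SimplexCategory.σ 1) (SimplexCategory.δ 1) (SimplexCategory.σ 0)
    (SimplexCategory.δ_comp_σ_succ (i := (1 : Fin 2)))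
    (SimplexCategory.δ_comp_σ_succ (i := (0 : Fin 1)))
    (SimplexCategory.δ_comp_σ_of_gt (i := (1 : Fin 2)) (j := (0 : Fin 1)) (by decide))
    (Subsingleton.elim _ _) (.of_comp (hF.cartesianOn_δ_one 0) ?_)
  rw [show SimplexCategory.δ (1 : Fin 3) ≫ SimplexCategory.σ (0 : Fin 2) = 𝟙 _ from
    SimplexCategory.δ_comp_σ_succ (i := (0 : Fin 2))]
  exact .of_isIso F _

theorem exists_cartesianOn_of_one (hF : IsULF F) (n : ℕ) :
    ∃ f : ⦋1⦌ ⟶ ⦋n + 1⦌, IsActive f ∧ CartesianOn F f := by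
  induction n with
  | zero => exact ⟨𝟙 _, ⟨rfl, rfl⟩, .of_isIso F _⟩
  | succ n ih =>
    obtain ⟨f, hf, hFf⟩ := ih
    exact ⟨f ≫ SimplexCategory.δ 1, hf.comp (.δ_one n), hFf.comp (hF.cartesianOn_δ_one n)⟩

theorem cartesianOn_of_one (hF : IsULF F) {y : SimplexCategory} {f : ⦋1⦌ ⟶ y}
    (hf : IsActive f) : CartesianOn F f := by
  induction y using SimplexCategory.rec with
  | _ n =>
    cases n with
    | zero =>
      rw [hf.eq_of_one (.σ 0)]
      exact hF.cartesianOn_σ_zero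
    | succ n =>
      obtain ⟨g, hg, hFg⟩ := hF.exists_cartesianOn_of_one n
      rwa [hf.eq_of_one hg]

theorem isCULF (hF : IsULF F) : IsCULF F := by
  intro x y α hα
  obtain ⟨f, hf⟩ := IsActive.exists_of_one x
  exact .of_comp (hF.cartesianOn_of_one hf) (hF.cartesianOn_of_one (hf.comp hα))

end IsULF

theorem IsCULF.isConservative {X Y : SimplicialObject C} {F : Y ⟶ X} (hF : IsCULF F) :
    IsConservative F :=
  fun _ i ↦ hF _ (.σ i)

/-- Any ULF simplicial map between decomposition objects is also conservative, and hence
CULF. -/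
theorem isConservative_and_isCULF_of_isULF {X Y : SimplicialObject C} (F : Y ⟶ X)
    (hY : IsDecomp Y) (hX : IsDecomp X) (hF : IsULF F) :
    IsConservative F ∧ IsCULF F :=
  ⟨hF.isCULF.isConservative, hF.isCULF⟩
end

section
/- If X is a decomposition object in a category C and F : Y → X is a CULF simplicial map, then Y is also a decomposition object. -/
open CategoryTheory CategoryTheory.Limits Simplicial Opposite

variable {C : Type*} [Category C]

/-- Two simplex category maps out of `p` agree if they agree on the images of `r` and `s`,
where `r` and `s` exhibit `p` as a pushout. -/
theorem apply_eq_of_isPushout {n m k p : SimplexCategory} {f : n ⟶ m} {g : n ⟶ k}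
    {r : m ⟶ p} {s : k ⟶ p} (h : IsPushout f g r s) {q : SimplexCategory}
    (u v : Fin (p.len + 1) →o Fin (q.len + 1))
    (hr : ∀ i, u (r.toOrderHom i) = v (r.toOrderHom i))
    (hs : ∀ i, u (s.toOrderHom i) = v (s.toOrderHom i)) : u = v := by
  have huv : SimplexCategory.Hom.mk u = SimplexCategory.Hom.mk v :=
    h.hom_ext (SimplexCategory.Hom.ext _ _ (OrderHom.ext _ _ (funext hr)))
      (SimplexCategory.Hom.ext _ _ (OrderHom.ext _ _ (funext hs)))
  exact congrArg SimplexCategory.Hom.toOrderHom huv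

/-- Active maps of the simplex category are stable under cobase change. -/
theorem IsActive.of_isPushout {n m k p : SimplexCategory} {f : n ⟶ m} {g : n ⟶ k}
    {r : m ⟶ p} {s : k ⟶ p} (hg : IsActive g) (h : IsPushout f g r s) : IsActive r := by
  have hw (i) : r.toOrderHom (f.toOrderHom i) = s.toOrderHom (g.toOrderHom i) :=
    DFunLike.congr_fun (congrArg SimplexCategory.Hom.toOrderHom h.w) i
  constructor
  · by_contra hne
    have hr (i) : r.toOrderHom i ≠ 0 := fun hi ↦
      hne (Fin.le_zero_iff.mp (hi ▸ r.toOrderHom.monotone (Fin.zero_le i)))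
    have hs (i) : s.toOrderHom i ≠ 0 := fun hi ↦
      hr (f.toOrderHom 0) (by
        rw [hw, hg.1]
        exact Fin.le_zero_iff.mp (hi ▸ s.toOrderHom.monotone (Fin.zero_le i)))
    let u : Fin (p.len + 1) →o Fin (⦋1⦌.len + 1) :=
      { toFun := fun x ↦ if x = 0 then 0 else 1
        monotone' := by
          intro x y hxy
          dsimp only
          split_ifs with hx hy hy
          · exact le_rfl
          · exact Fin.zero_le _
          · exact absurd (Fin.le_zero_iff.mp (hy ▸ hxy)) hx
          · exact le_rfl }
    have huv := apply_eq_of_isPushout h u (OrderHom.const _ 1)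
      (fun i ↦ if_neg (hr i)) (fun i ↦ if_neg (hs i))
    have hu : u 0 = 0 := rfl
    exact zero_ne_one (hu.symm.trans (DFunLike.congr_fun huv 0))
  · by_contra hne
    have hr (i) : r.toOrderHom i ≠ Fin.last p.len := fun hi ↦
      hne (Fin.last_le_iff.mp (hi ▸ r.toOrderHom.monotone (Fin.le_last i)))
    have hs (i) : s.toOrderHom i ≠ Fin.last p.len := fun hi ↦
      hr (f.toOrderHom (Fin.last _)) (by
        rw [hw, hg.2]
        exact Fin.last_le_iff.mp (hi ▸ s.toOrderHom.monotone (Fin.le_last i)))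
    let u : Fin (p.len + 1) →o Fin (⦋1⦌.len + 1) :=
      { toFun := fun x ↦ if x = Fin.last p.len then 1 else 0
        monotone' := by
          intro x y hxy
          dsimp only
          split_ifs with hx hy hy
          · exact le_rfl
          · exact absurd (Fin.last_le_iff.mp (hx ▸ hxy)) hy
          · exact Fin.zero_le _
          · exact le_rfl }
    have huv := apply_eq_of_isPushout h u (OrderHom.const _ 0)
      (fun i ↦ if_neg (hr i)) (fun i ↦ if_neg (hs i))
    have hu : u (Fin.last _) = 1 := if_pos rfl
    exact one_ne_zero (hu.symm.trans (DFunLike.congr_fun huv (Fin.last _)))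

/-- If `X` is a decomposition object and `F : Y ⟶ X` is CULF, then `Y` is a
decomposition object. -/
theorem isDecomp_of_isCULF {X Y : SimplicialObject C} (F : Y ⟶ X)
    (hX : IsDecomp X) (hF : IsCULF F) : IsDecomp Y := by
  intro n m k p f g r s hf hg h
  have hcomp := (hF r (hg.of_isPushout h)).flip.paste_horiz (hX f g r s hf hg h).flip
  rw [← F.naturality, ← F.naturality] at hcomp
  exact (IsPullback.of_right hcomp
    (by rw [← Y.map_comp, ← Y.map_comp, ← op_comp, ← op_comp, h.w]) (hF g hg).flip).flip
end
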